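/- The operator U(β̂ ⊕ β̂)U* − π'(β) on 𝓗 belongs to K_q, the smallest norm-closed two-sided ideal of the bounded operators on 𝓗 containing the diagonal operator Γ_q : u^n_{ij} ↦ q^n u^n_{ij}, d^n_{ij} ↦ q^n d^n_{ij}. -/

import Mathlib

noncomputable section

open Real

/-- Validity of an index triple `(N, I, J)` encoding `n = N/2`, `i = I/2`, `j = J/2`, with
`n ∈ ½ℤ₊` and `i, j ∈ {-n, -n+1, …, n}` (so `|I| ≤ N`, `|J| ≤ N` and `I ≡ J ≡ N (mod 2)`). -/
abbrev validH (x : ℤ × ℤ × ℤ) : Prop :=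
  0 ≤ x.1 ∧ |x.2.1| ≤ x.1 ∧ |x.2.2| ≤ x.1 ∧
    (x.1 + x.2.1) % 2 = 0 ∧ (x.1 + x.2.2) % 2 = 0

abbrev IdxH : Type := {x : ℤ × ℤ × ℤ // validH x}

/-- The Hilbert space `H = L₂(h)` with orthonormal basis `e^(n)_{ij}`. -/
abbrev Hsp : Type := lp (fun _ : IdxH => ℂ) 2

/-- The basis vector `e^(n)_{ij}` of `H`, where `n = N/2`, `i = I/2`, `j = J/2`;
it is `0` if the indices are out of range. -/
def eH (N I J : ℤ) : Hsp :=
  if h : validH (N, I, J) then lp.single 2 (⟨(N, I, J), h⟩ : IdxH) (1 : ℂ) else 0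

/-- the coefficient `q^(2n+i+j+1)` (here `n = N/2`, `i = I/2`, `j = J/2`) -/
def aC1 (q : ℝ) (N I J : ℤ) : ℝ := q ^ ((N : ℝ) + ((I : ℝ) + (J : ℝ)) / 2 + 1)

/-- the coefficient `(1-q^(2n+2i))^(1/2) * (1-q^(2n+2j))^(1/2)` -/
def aC2 (q : ℝ) (N I J : ℤ) : ℝ :=
  Real.sqrt (1 - q ^ ((N : ℝ) + (I : ℝ))) * Real.sqrt (1 - q ^ ((N : ℝ) + (J : ℝ)))

/-- the coefficient `-q^(n+j) * (1-q^(2n+2i+2))^(1/2)` -/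
def bC1 (q : ℝ) (N I J : ℤ) : ℝ :=
  -(q ^ (((N : ℝ) + (J : ℝ)) / 2)) * Real.sqrt (1 - q ^ ((N : ℝ) + (I : ℝ) + 2))

/-- the coefficient `q^(n+i) * (1-q^(2n+2j))^(1/2)` -/
def bC2 (q : ℝ) (N I J : ℤ) : ℝ :=
  q ^ (((N : ℝ) + (I : ℝ)) / 2) * Real.sqrt (1 - q ^ ((N : ℝ) + (J : ℝ)))

/-- `A` acts on the basis vectors of `H` by the defining formula of `α̂`:
`α̂ e^(n)_{ij} = q^(2n+i+j+1) e^(n+1/2)_{i-1/2,j-1/2}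
  + (1-q^(2n+2i))^(1/2) (1-q^(2n+2j))^(1/2) e^(n-1/2)_{i-1/2,j-1/2}`. -/
def IsAlphaHat (q : ℝ) (A : Hsp →L[ℂ] Hsp) : Prop :=
  ∀ N I J : ℤ, validH (N, I, J) →
    A (eH N I J) = (aC1 q N I J : ℂ) • eH (N + 1) (I - 1) (J - 1)
      + (aC2 q N I J : ℂ) • eH (N - 1) (I - 1) (J - 1)

/-- `B` acts on the basis vectors of `H` by the defining formula of `β̂`:
`β̂ e^(n)_{ij} = -q^(n+j) (1-q^(2n+2i+2))^(1/2) e^(n+1/2)_{i+1/2,j-1/2}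
  + q^(n+i) (1-q^(2n+2j))^(1/2) e^(n-1/2)_{i+1/2,j-1/2}`. -/
def IsBetaHat (q : ℝ) (B : Hsp →L[ℂ] Hsp) : Prop :=
  ∀ N I J : ℤ, validH (N, I, J) →
    B (eH N I J) = (bC1 q N I J : ℂ) • eH (N + 1) (I + 1) (J - 1)
      + (bC2 q N I J : ℂ) • eH (N - 1) (I + 1) (J - 1)

/-- The q-number `[m] = (q^m - q^(-m))/(q - q⁻¹)`. -/
def qnum (q m : ℝ) : ℝ := (q ^ m - q ^ (-m)) / (q - q⁻¹)

/-- The 2×2 matrix `a⁺_{nij}`. -/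
def aP (q n i j : ℝ) : Matrix (Fin 2) (Fin 2) ℝ :=
  (q ^ ((i + j - 1/2) / 2) * Real.sqrt (qnum q (n + i + 1))) •
    !![q ^ (-n - 1/2) * Real.sqrt (qnum q (n + j + 3/2)) / qnum q (2*n + 2), 0;
       q ^ ((1:ℝ)/2) * Real.sqrt (qnum q (n - j + 1/2)) / (qnum q (2*n + 1) * qnum q (2*n + 2)),
       q ^ (-n) * Real.sqrt (qnum q (n + j + 1/2)) / qnum q (2*n + 1)]

/-- The 2×2 matrix `a⁻_{nij}`. -/
def aM (q n i j : ℝ) : Matrix (Fin 2) (Fin 2) ℝ :=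
  (q ^ ((i + j - 1/2) / 2) * Real.sqrt (qnum q (n - i))) •
    !![q ^ (n + 1) * Real.sqrt (qnum q (n - j + 1/2)) / qnum q (2*n + 1),
       -(q ^ ((1:ℝ)/2) * Real.sqrt (qnum q (n + j + 1/2)) / (qnum q (2*n) * qnum q (2*n + 1)));
       0, q ^ (n + 1/2) * Real.sqrt (qnum q (n - j - 1/2)) / qnum q (2*n)]

/-- The 2×2 matrix `b⁺_{nij}`. -/
def bP (q n i j : ℝ) : Matrix (Fin 2) (Fin 2) ℝ :=
  (q ^ ((i + j - 1/2) / 2) * Real.sqrt (qnum q (n + i + 1))) •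
    !![Real.sqrt (qnum q (n - j + 3/2)) / qnum q (2*n + 2), 0;
       -(q ^ (-n - 1) * Real.sqrt (qnum q (n + j + 1/2)) / (qnum q (2*n + 1) * qnum q (2*n + 2))),
       q ^ (-(1:ℝ)/2) * Real.sqrt (qnum q (n - j + 1/2)) / qnum q (2*n + 1)]

/-- The 2×2 matrix `b⁻_{nij}`. -/
def bM (q n i j : ℝ) : Matrix (Fin 2) (Fin 2) ℝ :=
  (q ^ ((i + j - 1/2) / 2) * Real.sqrt (qnum q (n - i))) •
    !![-(q ^ (-(1:ℝ)/2) * Real.sqrt (qnum q (n + j + 1/2)) / qnum q (2*n + 1)),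
       -(q ^ n * Real.sqrt (qnum q (n - j + 1/2)) / (qnum q (2*n) * qnum q (2*n + 1)));
       0, -(Real.sqrt (qnum q (n + j - 1/2)) / qnum q (2*n))]

/-- `n` is a nonnegative half-integer: `n ∈ ½ℤ₊ = {0, 1/2, 1, 3/2, …}`. -/
def HalfNat (n : ℝ) : Prop := ∃ N : ℕ, (N : ℝ) = 2 * n

/-- `i ∈ {-n, -n+1, …, n}`. -/
def IdxRange (n i : ℝ) : Prop := (∃ k : ℕ, (k : ℝ) = i + n) ∧ i ≤ n

/-- `j ∈ {-n+1/2, -n+3/2, …, n-1/2}`. -/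
def JRangeIn (n j : ℝ) : Prop := (∃ k : ℕ, (k : ℝ) = j + n - 1/2) ∧ j ≤ n - 1/2

/-- `j ∈ {-n-1/2, -n+1/2, …, n+1/2}`. -/
def JRangeOut (n j : ℝ) : Prop := (∃ k : ℕ, (k : ℝ) = j + n + 1/2) ∧ j ≤ n + 1/2

/-- Validity of an index triple `(N, I, J)` (with `n = N/2`, `i = I/2`, `j = J/2`) for the basis
vectors `u^n_{ij}` of `𝓗`: `n ∈ ½ℤ₊`, `i ∈ {-n, …, n}`, `j ∈ {-n-1/2, …, n+1/2}`. -/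
abbrev validU (x : ℤ × ℤ × ℤ) : Prop :=
  0 ≤ x.1 ∧ |x.2.1| ≤ x.1 ∧ (x.1 + x.2.1) % 2 = 0 ∧
    |x.2.2| ≤ x.1 + 1 ∧ (x.1 + 1 + x.2.2) % 2 = 0

/-- Validity of an index triple `(N, I, J)` (with `n = N/2`, `i = I/2`, `j = J/2`) for the basis
vectors `d^n_{ij}` of `𝓗`: `n ≥ 1/2`, `i ∈ {-n, …, n}`, `j ∈ {-n+1/2, …, n-1/2}`. -/
abbrev validD (x : ℤ × ℤ × ℤ) : Prop :=
  1 ≤ x.1 ∧ |x.2.1| ≤ x.1 ∧ (x.1 + x.2.1) % 2 = 0 ∧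
    |x.2.2| ≤ x.1 - 1 ∧ (x.1 + 1 + x.2.2) % 2 = 0

abbrev IdxW : Type := {x : ℤ × ℤ × ℤ // validU x} ⊕ {x : ℤ × ℤ × ℤ // validD x}

/-- The Hilbert space `𝓗` with orthonormal basis `{u^n_{ij}} ∪ {d^n_{ij}}`. -/
abbrev Wsp : Type := lp (fun _ : IdxW => ℂ) 2

/-- The basis vector `u^n_{ij}` of `𝓗` (zero if out of range). -/
def eU (N I J : ℤ) : Wsp :=
  if h : validU (N, I, J) then lp.single 2 (Sum.inl ⟨(N, I, J), h⟩ : IdxW) (1 : ℂ) else 0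

/-- The basis vector `d^n_{ij}` of `𝓗` (zero if out of range, in particular for
`j = ±(n+1/2)`). -/
def eD (N I J : ℤ) : Wsp :=
  if h : validD (N, I, J) then lp.single 2 (Sum.inr ⟨(N, I, J), h⟩ : IdxW) (1 : ℂ) else 0

/-- The Hilbert space `H ⊕ H`. -/
abbrev Ksp : Type := WithLp 2 (Hsp × Hsp)

/-- `v ⊕ 0` as an element of `H ⊕ H` -/
def eK1 (v : Hsp) : Ksp := (WithLp.equiv 2 (Hsp × Hsp)).symm (v, 0)

/-- `0 ⊕ v` as an element of `H ⊕ H` -/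
def eK2 (v : Hsp) : Ksp := (WithLp.equiv 2 (Hsp × Hsp)).symm (0, v)

/-- `U : H ⊕ H → 𝓗` acts on the basis vectors by `U(e^(n)_{ij} ⊕ 0) = d^n_{i,j+1/2}` for
`-n ≤ j ≤ n-1`, `U(e^(n)_{in} ⊕ 0) = u^n_{i,n+1/2}`, and `U(0 ⊕ e^(n)_{ij}) = u^n_{i,j-1/2}`. -/
def IsUmap (U : Ksp ≃ₗᵢ[ℂ] Wsp) : Prop :=
  (∀ N I J : ℤ, validH (N, I, J) → J ≠ N → U (eK1 (eH N I J)) = eD N I (J + 1)) ∧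
  (∀ N I : ℤ, validH (N, I, N) → U (eK1 (eH N I N)) = eU N I (N + 1)) ∧
  (∀ N I J : ℤ, validH (N, I, J) → U (eK2 (eH N I J)) = eU N I (J - 1))

/-- the half-integer `N/2` as a real number -/
def nn (N : ℤ) : ℝ := (N : ℝ) / 2

/-- `P` acts on the basis vectors of `𝓗` by the defining formula of `π'(α*)`:
`π'(α*) v^n_{ij} = a⁺_{nij} v^(n+1/2)_{i+1/2,j+1/2} + a⁻_{nij} v^(n-1/2)_{i+1/2,j+1/2}`,
where `v^n_{ij} = (u^n_{ij}, d^n_{ij})` and a matrix `M` applied to the source pair gives the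
coefficient `M₁₁u + M₁₂d` of the target `u`-vector and `M₂₁u + M₂₂d` of the target `d`-vector. -/
def IsPiAlphaStar (q : ℝ) (P : Wsp →L[ℂ] Wsp) : Prop :=
  (∀ N I J : ℤ, validU (N, I, J) →
    P (eU N I J) =
      (aP q (nn N) (nn I) (nn J) 0 0 : ℂ) • eU (N + 1) (I + 1) (J + 1)
      + (aP q (nn N) (nn I) (nn J) 1 0 : ℂ) • eD (N + 1) (I + 1) (J + 1)
      + (aM q (nn N) (nn I) (nn J) 0 0 : ℂ) • eU (N - 1) (I + 1) (J + 1)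
      + (aM q (nn N) (nn I) (nn J) 1 0 : ℂ) • eD (N - 1) (I + 1) (J + 1)) ∧
  (∀ N I J : ℤ, validD (N, I, J) →
    P (eD N I J) =
      (aP q (nn N) (nn I) (nn J) 0 1 : ℂ) • eU (N + 1) (I + 1) (J + 1)
      + (aP q (nn N) (nn I) (nn J) 1 1 : ℂ) • eD (N + 1) (I + 1) (J + 1)
      + (aM q (nn N) (nn I) (nn J) 0 1 : ℂ) • eU (N - 1) (I + 1) (J + 1)
      + (aM q (nn N) (nn I) (nn J) 1 1 : ℂ) • eD (N - 1) (I + 1) (J + 1))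

/-- `P` acts on the basis vectors of `𝓗` by the defining formula of `π'(β)`:
`π'(β) v^n_{ij} = -(b⁺_{nij} v^(n+1/2)_{i+1/2,j-1/2} + b⁻_{nij} v^(n-1/2)_{i+1/2,j-1/2})`. -/
def IsPiBeta (q : ℝ) (P : Wsp →L[ℂ] Wsp) : Prop :=
  (∀ N I J : ℤ, validU (N, I, J) →
    P (eU N I J) =
      (-(bP q (nn N) (nn I) (nn J) 0 0) : ℂ) • eU (N + 1) (I + 1) (J - 1)
      + (-(bP q (nn N) (nn I) (nn J) 1 0) : ℂ) • eD (N + 1) (I + 1) (J - 1)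
      + (-(bM q (nn N) (nn I) (nn J) 0 0) : ℂ) • eU (N - 1) (I + 1) (J - 1)
      + (-(bM q (nn N) (nn I) (nn J) 1 0) : ℂ) • eD (N - 1) (I + 1) (J - 1)) ∧
  (∀ N I J : ℤ, validD (N, I, J) →
    P (eD N I J) =
      (-(bP q (nn N) (nn I) (nn J) 0 1) : ℂ) • eU (N + 1) (I + 1) (J - 1)
      + (-(bP q (nn N) (nn I) (nn J) 1 1) : ℂ) • eD (N + 1) (I + 1) (J - 1)
      + (-(bM q (nn N) (nn I) (nn J) 0 1) : ℂ) • eU (N - 1) (I + 1) (J - 1)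
      + (-(bM q (nn N) (nn I) (nn J) 1 1) : ℂ) • eD (N - 1) (I + 1) (J - 1))

/-- the direct sum `T ⊕ T` as a bounded operator on `H ⊕ H` -/
def dsum (T : Hsp →L[ℂ] Hsp) : Ksp →L[ℂ] Ksp :=
  (((WithLp.prodContinuousLinearEquiv 2 ℂ Hsp Hsp).symm : Hsp × Hsp →L[ℂ] Ksp)).comp
    ((T.prodMap T).comp
      ((WithLp.prodContinuousLinearEquiv 2 ℂ Hsp Hsp : Ksp ≃L[ℂ] Hsp × Hsp) : Ksp →L[ℂ] Hsp × Hsp))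

/-- `G` is the diagonal operator `Γ_q : u^n_{ij} ↦ q^n u^n_{ij}, d^n_{ij} ↦ q^n d^n_{ij}`. -/
def IsGammaQ (q : ℝ) (G : Wsp →L[ℂ] Wsp) : Prop :=
  (∀ N I J : ℤ, validU (N, I, J) →
    G (eU N I J) = ((q ^ ((N : ℝ) / 2) : ℝ) : ℂ) • eU N I J) ∧
  (∀ N I J : ℤ, validD (N, I, J) →
    G (eD N I J) = ((q ^ ((N : ℝ) / 2) : ℝ) : ℂ) • eD N I J)

section Coefficients

variable {q : ℝ}

lemma inv_sub_self_pos (hq0 : 0 < q) (hq1 : q < 1) : 0 < q⁻¹ - q :=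
  sub_pos.2 (hq1.trans ((one_lt_inv₀ hq0).2 hq1))

lemma qnum_eq (hq0 : 0 < q) (m : ℝ) :
    qnum q m = q ^ (-m) * (1 - q ^ (2 * m)) / (q⁻¹ - q) := by
  have h : q ^ (-m) * q ^ (2 * m) = q ^ m := by rw [← rpow_add hq0]; ring_nf
  rw [qnum, ← neg_div_neg_eq, mul_sub, h]
  ring_nf

lemma sqrt_qnum (hq0 : 0 < q) (hq1 : q < 1) (m : ℝ) :
    √(qnum q m) = q ^ (-(m / 2)) * √(1 - q ^ (2 * m)) / √(q⁻¹ - q) := by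
  have h : q ^ (-m) = q ^ (-(m / 2)) * q ^ (-(m / 2)) := by
    rw [← rpow_add hq0]; ring_nf
  rw [qnum_eq hq0, sqrt_div' _ (inv_sub_self_pos hq0 hq1).le, sqrt_mul (rpow_nonneg hq0.le _), h,
    sqrt_mul_self (rpow_nonneg hq0.le _)]

lemma sqrt_qnum_mul_sqrt_qnum_div (hq0 : 0 < q) (hq1 : q < 1) (a b c : ℝ) :
    √(qnum q a) * √(qnum q b) / qnum q c = q ^ (c - a / 2 - b / 2) *
      (√(1 - q ^ (2 * a)) * √(1 - q ^ (2 * b)) / (1 - q ^ (2 * c))) := by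
  have hκ := inv_sub_self_pos hq0 hq1
  have hw : √(q⁻¹ - q) * √(q⁻¹ - q) = q⁻¹ - q := mul_self_sqrt hκ.le
  have he : q ^ (c - a / 2 - b / 2) = (q ^ (-c))⁻¹ * q ^ (-(a / 2)) * q ^ (-(b / 2)) := by
    rw [← rpow_neg hq0.le, ← rpow_add hq0, ← rpow_add hq0]; ring_nf
  rw [sqrt_qnum hq0 hq1, sqrt_qnum hq0 hq1, qnum_eq hq0, he, div_mul_div_comm, hw,
    div_div_div_cancel_right₀ hκ.ne']
  simp only [div_eq_mul_inv, mul_inv]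
  ring

lemma sqrt_qnum_mul_sqrt_qnum_div_mul (hq0 : 0 < q) (hq1 : q < 1) (a b c d : ℝ) :
    √(qnum q a) * √(qnum q b) / (qnum q c * qnum q d) = q ^ (c + d - a / 2 - b / 2) *
      ((q⁻¹ - q) * (√(1 - q ^ (2 * a)) * √(1 - q ^ (2 * b)) /
        ((1 - q ^ (2 * c)) * (1 - q ^ (2 * d))))) := by
  have he : q ^ (c + d - a / 2 - b / 2) = q ^ (c - a / 2 - b / 2) * (q ^ (-d))⁻¹ := by
    rw [← rpow_neg hq0.le, ← rpow_add hq0]; ring_nf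
  rw [← div_div, sqrt_qnum_mul_sqrt_qnum_div hq0 hq1, qnum_eq hq0 d, he]
  simp only [div_eq_mul_inv, mul_inv, inv_inv]
  ring

lemma bP_zero_zero (hq0 : 0 < q) (hq1 : q < 1) (n i j : ℝ) :
    bP q n i j 0 0 = q ^ (n + j + 1 / 2) *
      (√(1 - q ^ (2 * (n + i + 1))) * √(1 - q ^ (2 * (n - j + 3 / 2))) /
        (1 - q ^ (2 * (2 * n + 2)))) := by
  simp only [bP, Matrix.smul_apply, Matrix.of_apply, Matrix.cons_val', Matrix.cons_val_zero,
    Matrix.cons_val_fin_one, smul_eq_mul]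
  rw [mul_assoc, ← mul_div_assoc, sqrt_qnum_mul_sqrt_qnum_div hq0 hq1, ← mul_assoc,
    ← rpow_add hq0]
  ring_nf

lemma bP_one_zero (hq0 : 0 < q) (hq1 : q < 1) (n i j : ℝ) :
    bP q n i j 1 0 = -(q ^ (2 * n + 1) * ((q⁻¹ - q) *
      (√(1 - q ^ (2 * (n + i + 1))) * √(1 - q ^ (2 * (n + j + 1 / 2))) /
        ((1 - q ^ (2 * (2 * n + 1))) * (1 - q ^ (2 * (2 * n + 2))))))) := by
  have he : q ^ (2 * n + 1) = q ^ ((i + j - 1 / 2) / 2) * q ^ (-n - 1) *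
      q ^ (2 * n + 1 + (2 * n + 2) - (n + i + 1) / 2 - (n + j + 1 / 2) / 2) := by
    rw [← rpow_add hq0, ← rpow_add hq0]; ring_nf
  rw [he, mul_assoc _ (q ^ (2 * n + 1 + (2 * n + 2) - (n + i + 1) / 2 - (n + j + 1 / 2) / 2)),
    ← sqrt_qnum_mul_sqrt_qnum_div_mul hq0 hq1]
  simp only [bP, Matrix.smul_apply, Matrix.of_apply, Matrix.cons_val', Matrix.cons_val_zero,
    Matrix.cons_val_one, Matrix.cons_val_fin_one, smul_eq_mul]
  ring

lemma bP_zero_one (n i j : ℝ) : bP q n i j 0 1 = 0 := by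
  simp [bP]

lemma bP_one_one (hq0 : 0 < q) (hq1 : q < 1) (n i j : ℝ) :
    bP q n i j 1 1 = q ^ (n + j - 1 / 2) *
      (√(1 - q ^ (2 * (n + i + 1))) * √(1 - q ^ (2 * (n - j + 1 / 2))) /
        (1 - q ^ (2 * (2 * n + 1)))) := by
  have he : q ^ (n + j - 1 / 2) = q ^ ((i + j - 1 / 2) / 2) * q ^ (-(1 : ℝ) / 2) *
      q ^ (2 * n + 1 - (n + i + 1) / 2 - (n - j + 1 / 2) / 2) := by
    rw [← rpow_add hq0, ← rpow_add hq0]; ring_nf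
  rw [he, mul_assoc _ (q ^ (2 * n + 1 - (n + i + 1) / 2 - (n - j + 1 / 2) / 2)),
    ← sqrt_qnum_mul_sqrt_qnum_div hq0 hq1]
  simp only [bP, Matrix.smul_apply, Matrix.of_apply, Matrix.cons_val',
    Matrix.cons_val_one, Matrix.cons_val_fin_one, smul_eq_mul]
  ring

lemma bM_zero_zero (hq0 : 0 < q) (hq1 : q < 1) (n i j : ℝ) :
    bM q n i j 0 0 = -(q ^ (n + i) *
      (√(1 - q ^ (2 * (n - i))) * √(1 - q ^ (2 * (n + j + 1 / 2))) /
        (1 - q ^ (2 * (2 * n + 1))))) := by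
  have he : q ^ (n + i) = q ^ ((i + j - 1 / 2) / 2) * q ^ (-(1 : ℝ) / 2) *
      q ^ (2 * n + 1 - (n - i) / 2 - (n + j + 1 / 2) / 2) := by
    rw [← rpow_add hq0, ← rpow_add hq0]; ring_nf
  rw [he, mul_assoc _ (q ^ (2 * n + 1 - (n - i) / 2 - (n + j + 1 / 2) / 2)),
    ← sqrt_qnum_mul_sqrt_qnum_div hq0 hq1]
  simp only [bM, Matrix.smul_apply, Matrix.of_apply, Matrix.cons_val', Matrix.cons_val_zero,
    Matrix.cons_val_fin_one, smul_eq_mul]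
  ring

lemma bM_zero_one (hq0 : 0 < q) (hq1 : q < 1) (n i j : ℝ) :
    bM q n i j 0 1 = -(q ^ (4 * n + i + j + 1 / 2) * ((q⁻¹ - q) *
      (√(1 - q ^ (2 * (n - i))) * √(1 - q ^ (2 * (n - j + 1 / 2))) /
        ((1 - q ^ (2 * (2 * n))) * (1 - q ^ (2 * (2 * n + 1))))))) := by
  have he : q ^ (4 * n + i + j + 1 / 2) = q ^ ((i + j - 1 / 2) / 2) * q ^ n *
      q ^ (2 * n + (2 * n + 1) - (n - i) / 2 - (n - j + 1 / 2) / 2) := by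
    rw [← rpow_add hq0, ← rpow_add hq0]; ring_nf
  rw [he, mul_assoc _ (q ^ (2 * n + (2 * n + 1) - (n - i) / 2 - (n - j + 1 / 2) / 2)),
    ← sqrt_qnum_mul_sqrt_qnum_div_mul hq0 hq1]
  simp only [bM, Matrix.smul_apply, Matrix.of_apply, Matrix.cons_val', Matrix.cons_val_zero,
    Matrix.cons_val_one, Matrix.cons_val_fin_one, smul_eq_mul]
  ring

lemma bM_one_zero (n i j : ℝ) : bM q n i j 1 0 = 0 := by
  simp [bM]

lemma bM_one_one (hq0 : 0 < q) (hq1 : q < 1) (n i j : ℝ) :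
    bM q n i j 1 1 = -(q ^ (n + i) *
      (√(1 - q ^ (2 * (n - i))) * √(1 - q ^ (2 * (n + j - 1 / 2))) /
        (1 - q ^ (2 * (2 * n))))) := by
  have he : q ^ (n + i) = q ^ ((i + j - 1 / 2) / 2) *
      q ^ (2 * n - (n - i) / 2 - (n + j - 1 / 2) / 2) := by
    rw [← rpow_add hq0]; ring_nf
  rw [he, mul_assoc _ (q ^ (2 * n - (n - i) / 2 - (n + j - 1 / 2) / 2)),
    ← sqrt_qnum_mul_sqrt_qnum_div hq0 hq1]
  simp only [bM, Matrix.smul_apply, Matrix.of_apply, Matrix.cons_val',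
    Matrix.cons_val_one, Matrix.cons_val_fin_one, smul_eq_mul]
  ring

lemma sqrt_le_one_of_le {x : ℝ} (hx : 0 ≤ x) : √(1 - x) ≤ 1 :=
  sqrt_le_one.2 (by linarith)

lemma one_sub_sqrt_le {x : ℝ} (hx0 : 0 ≤ x) (hx : x ≤ 1) : 1 - √(1 - x) ≤ x := by
  have : 1 - x ≤ √(1 - x) := Real.le_sqrt_of_sq_le (by nlinarith)
  linarith

lemma abs_mul_div_sub_le {p s x y d r : ℝ} (hp : 0 ≤ p) (hs0 : 0 ≤ s) (hs1 : s ≤ 1)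
    (hx0 : 0 ≤ x) (hx1 : x ≤ 1) (hy0 : 0 ≤ y) (hd : 0 < d) (hyd : d ≤ 1 - y)
    (hpx : p * x ≤ r) (hpy : p * y ≤ r) :
    |p * (s * √(1 - x) / (1 - y)) - p * s| ≤ 2 / d * r := by
  have h1 := one_sub_sqrt_le hx0 hx1
  have h2 := sqrt_le_one_of_le hx0
  have hy : 0 < 1 - y := hd.trans_le hyd
  have : p * (s * √(1 - x) / (1 - y)) - p * s = p * s * (√(1 - x) - (1 - y)) / (1 - y) := by
    field_simp
  have h3 : |√(1 - x) - (1 - y)| ≤ x + y := abs_le.2 ⟨by linarith, by linarith⟩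
  rw [this, abs_div, abs_of_pos hy, abs_mul, abs_of_nonneg (mul_nonneg hp hs0)]
  calc p * s * |√(1 - x) - (1 - y)| / (1 - y) ≤ p * 1 * (x + y) / d := by gcongr
    _ = (p * x + p * y) / d := by ring
    _ ≤ (r + r) / d := by gcongr
    _ = 2 / d * r := by ring

lemma abs_mul_sqrt_mul_sqrt_div_le {p s t y d : ℝ} (hp : 0 ≤ p) (hs0 : 0 ≤ s) (hs1 : s ≤ 1)
    (ht0 : 0 ≤ t) (ht1 : t ≤ 1) (hd : 0 < d) (hyd : d ≤ y) :
    |p * (s * t / y)| ≤ p / d := by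
  have hy : 0 < y := hd.trans_le hyd
  rw [abs_of_nonneg (by positivity), mul_div_assoc', div_le_div_iff₀ hy hd]
  have : s * t ≤ 1 := mul_le_one₀ hs1 ht0 ht1
  calc p * (s * t) * d ≤ p * 1 * y := by gcongr
    _ = p * y := by ring

end Coefficients

section Operators

lemma exists_clm_single_eq {ι E : Type*} [DecidableEq ι] [NormedAddCommGroup E]
    [InnerProductSpace ℂ E] [CompleteSpace E] (v : ι → E) (C : ℝ)
    (hv : Pairwise fun i j => inner ℂ (v i) (v j) = 0) (hC : ∀ i, ‖v i‖ ≤ C) :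
    ∃ T : lp (fun _ : ι => ℂ) 2 →L[ℂ] E, ∀ i, T (lp.single 2 i 1) = v i := by
  let G : ι → Submodule ℂ E := fun i => ℂ ∙ v i
  have hG : OrthogonalFamily ℂ (fun i => G i) fun i => (G i).subtypeₗᵢ := by
    refine OrthogonalFamily.of_pairwise fun i j hij => ?_
    rw [Function.onFun, Submodule.isOrtho_span]
    rintro x rfl y rfl
    exact hv hij
  let w : ∀ i, G i := fun i => ⟨v i, Submodule.mem_span_singleton_self _⟩
  have hle (x : lp (fun _ : ι => ℂ) 2) (i : ι) : ‖x i • w i‖ ≤ ‖((C : ℂ) • x) i‖ := by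
    have hC' : ‖w i‖ ≤ |C| := (hC i).trans (le_abs_self C)
    rw [norm_smul, lp.coeFn_smul, Pi.smul_apply, norm_smul, mul_comm, Complex.norm_real,
      Real.norm_eq_abs]
    gcongr
  let S : lp (fun _ : ι => ℂ) 2 →ₗ[ℂ] lp (fun i => G i) 2 :=
    { toFun := fun x => ⟨fun i => x i • w i, (lp.memℓp ((C : ℂ) • x)).mono' (hle x)⟩
      map_add' := fun x y => by ext i; exact congrArg _ (add_smul (x i) (y i) (w i))
      map_smul' := fun c x => by ext i; simp [mul_smul] }
  let S' := S.mkContinuous |C| fun x => by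
    refine (lp.norm_mono two_ne_zero (hle x)).trans_eq ?_
    rw [norm_smul, Complex.norm_real, Real.norm_eq_abs]
  refine ⟨hG.linearIsometry.toContinuousLinearMap.comp S', fun i => ?_⟩
  have hS : S' (lp.single 2 i 1) = lp.single 2 i (w i) := by
    ext j
    change ((lp.single 2 i (1 : ℂ) : lp (fun _ : ι => ℂ) 2) j • w j : E) = _
    rcases eq_or_ne j i with rfl | h
    · simp
    · simp [h]
  rw [ContinuousLinearMap.comp_apply, hS]
  exact hG.linearIsometry_apply_single (w i)

lemma clm_ext_single {ι E : Type*} [DecidableEq ι] [NormedAddCommGroup E]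
    [NormedSpace ℂ E] {S T : lp (fun _ : ι => ℂ) 2 →L[ℂ] E}
    (h : ∀ i, S (lp.single 2 i 1) = T (lp.single 2 i 1)) : S = T := by
  ext x
  have hx := lp.hasSum_single (p := 2) (by simp) x
  refine (hx.mapL S).unique ?_
  convert! hx.mapL T using 2 with i
  rw [← mul_one (x i), ← smul_eq_mul, lp.single_smul, map_smul, map_smul, h]

lemma eU_eq_single (x : {x : ℤ × ℤ × ℤ // validU x}) :
    eU x.1.1 x.1.2.1 x.1.2.2 = lp.single 2 (Sum.inl x : IdxW) (1 : ℂ) :=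
  dif_pos x.2

lemma eD_eq_single (x : {x : ℤ × ℤ × ℤ // validD x}) :
    eD x.1.1 x.1.2.1 x.1.2.2 = lp.single 2 (Sum.inr x : IdxW) (1 : ℂ) :=
  dif_pos x.2

lemma norm_eU_le (N I J : ℤ) : ‖eU N I J‖ ≤ 1 := by
  unfold eU; split_ifs <;> simp

lemma norm_eD_le (N I J : ℤ) : ‖eD N I J‖ ≤ 1 := by
  unfold eD; split_ifs <;> simp

lemma inner_eU_eU {N I J N' I' J' : ℤ} (h : (N, I, J) ≠ (N', I', J')) :
    inner ℂ (eU N I J) (eU N' I' J') = 0 := by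
  unfold eU
  split_ifs <;> simp [lp.inner_single_left, lp.single_apply, h]

lemma inner_eD_eD {N I J N' I' J' : ℤ} (h : (N, I, J) ≠ (N', I', J')) :
    inner ℂ (eD N I J) (eD N' I' J') = 0 := by
  unfold eD
  split_ifs <;> simp [lp.inner_single_left, lp.single_apply, h]

lemma inner_eU_eD (N I J N' I' J' : ℤ) : inner ℂ (eU N I J) (eD N' I' J') = 0 := by
  unfold eU eD
  split_ifs <;> simp [lp.inner_single_left, lp.single_apply]

lemma inner_eD_eU (N I J N' I' J' : ℤ) : inner ℂ (eD N I J) (eU N' I' J') = 0 :=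
  inner_eq_zero_symm.1 (inner_eU_eD ..)

/-- The images of the basis vectors of `𝓗` under the shift `(n, i, j) ↦ (n + s/2, i + 1/2, j - 1/2)`
that preserves the type `u` or `d`. -/
def straightShift (s : ℤ) : IdxW → Wsp :=
  Sum.elim (fun x => eU (x.1.1 + s) (x.1.2.1 + 1) (x.1.2.2 - 1))
    (fun x => eD (x.1.1 + s) (x.1.2.1 + 1) (x.1.2.2 - 1))

/-- The images of the basis vectors of `𝓗` under the shifts
`u^n_{ij} ↦ d^(n+1/2)_{i+1/2,j-1/2}` and `d^n_{ij} ↦ u^(n-1/2)_{i+1/2,j-1/2}`. -/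
def crossShift : IdxW → Wsp :=
  Sum.elim (fun x => eD (x.1.1 + 1) (x.1.2.1 + 1) (x.1.2.2 - 1))
    (fun x => eU (x.1.1 - 1) (x.1.2.1 + 1) (x.1.2.2 - 1))

lemma pairwise_inner_straightShift (s : ℤ) :
    Pairwise fun k l => inner ℂ (straightShift s k) (straightShift s l) = 0 := by
  rintro (⟨⟨N, I, J⟩, hk⟩ | ⟨⟨N, I, J⟩, hk⟩) (⟨⟨N', I', J'⟩, hl⟩ | ⟨⟨N', I', J'⟩, hl⟩) h
  · exact inner_eU_eU (by simpa using h)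
  · exact inner_eU_eD ..
  · exact inner_eD_eU ..
  · exact inner_eD_eD (by simpa using h)

lemma pairwise_inner_crossShift :
    Pairwise fun k l => inner ℂ (crossShift k) (crossShift l) = 0 := by
  rintro (⟨⟨N, I, J⟩, hk⟩ | ⟨⟨N, I, J⟩, hk⟩) (⟨⟨N', I', J'⟩, hl⟩ | ⟨⟨N', I', J'⟩, hl⟩) h
  · exact inner_eD_eD (by simpa using h)
  · exact inner_eD_eU ..
  · exact inner_eU_eD ..
  · exact inner_eU_eU (by simpa using h)

lemma norm_straightShift_le (s : ℤ) (k : IdxW) : ‖straightShift s k‖ ≤ 1 := by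
  rcases k with k | k
  · exact norm_eU_le ..
  · exact norm_eD_le ..

lemma norm_crossShift_le (k : IdxW) : ‖crossShift k‖ ≤ 1 := by
  rcases k with k | k
  · exact norm_eD_le ..
  · exact norm_eU_le ..

lemma exists_clm_smul {v : IdxW → Wsp} (hv : Pairwise fun k l => inner ℂ (v k) (v l) = 0)
    (hv1 : ∀ k, ‖v k‖ ≤ 1) {a : IdxW → ℝ} {C : ℝ} (ha : ∀ k, |a k| ≤ C) :
    ∃ T : Wsp →L[ℂ] Wsp, ∀ k, T (lp.single 2 k 1) = (a k : ℂ) • v k := by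
  refine exists_clm_single_eq (fun k => (a k : ℂ) • v k) C (fun k l h => ?_) fun k => ?_
  · simp [hv h]
  · rw [norm_smul, Complex.norm_real, Real.norm_eq_abs]
    exact (mul_le_of_le_one_right (abs_nonneg _) (hv1 k)).trans (ha k)

/-- the doubled level `2n` of a basis vector of `𝓗` -/
def level : IdxW → ℤ := Sum.elim (fun x => x.1.1) (fun x => x.1.1)

lemma isGammaQ_single {q : ℝ} {G : Wsp →L[ℂ] Wsp} (hG : IsGammaQ q G) (k : IdxW) :
    G (lp.single 2 k 1) = ((q ^ ((level k : ℝ) / 2) : ℝ) : ℂ) • lp.single 2 k 1 := by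
  rcases k with k | k
  · rw [← eU_eq_single]
    exact hG.1 _ _ _ k.2
  · rw [← eD_eq_single]
    exact hG.2 _ _ _ k.2

/-- An operator whose matrix entries along the shifts of level `±1` are `O(q^n)` factors through
`Γ_q`. -/
lemma mem_of_shift_coeff_bound {q : ℝ} (hq0 : 0 < q) {G : Wsp →L[ℂ] Wsp} (hG : IsGammaQ q G)
    {I : TwoSidedIdeal (Wsp →L[ℂ] Wsp)} (hGI : G ∈ I) {D : Wsp →L[ℂ] Wsp} {C : ℝ}
    (hD : ∀ k : IdxW, ∃ a b c : ℝ, |a| ≤ C * q ^ ((level k : ℝ) / 2) ∧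
      |b| ≤ C * q ^ ((level k : ℝ) / 2) ∧ |c| ≤ C * q ^ ((level k : ℝ) / 2) ∧
      D (lp.single 2 k 1) = (a : ℂ) • straightShift 1 k + (b : ℂ) • straightShift (-1) k
        + (c : ℂ) • crossShift k) : D ∈ I := by
  choose a b c ha hb hc hD using hD
  let g : IdxW → ℝ := fun k => q ^ ((level k : ℝ) / 2)
  have hg (k : IdxW) : 0 < g k := rpow_pos_of_pos hq0 _
  have hdiv {f : IdxW → ℝ} (hf : ∀ k, |f k| ≤ C * g k) (k : IdxW) : |f k / g k| ≤ C := by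
    rw [abs_div, abs_of_pos (hg k), div_le_iff₀ (hg k)]
    exact hf k
  obtain ⟨A, hA⟩ :=
    exists_clm_smul (pairwise_inner_straightShift 1) (norm_straightShift_le 1) (hdiv ha)
  obtain ⟨B, hB⟩ :=
    exists_clm_smul (pairwise_inner_straightShift (-1)) (norm_straightShift_le (-1)) (hdiv hb)
  obtain ⟨T, hT⟩ := exists_clm_smul pairwise_inner_crossShift norm_crossShift_le (hdiv hc)
  have : D = (A + B + T) * G := by
    refine clm_ext_single fun k => ?_
    have hk : (g k : ℂ) ≠ 0 := Complex.ofReal_ne_zero.2 (hg k).ne'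
    rw [mul_apply_eq_comp, isGammaQ_single hG, map_smul,
      add_apply, add_apply, hA, hB, hT, hD]
    change _ = (g k : ℂ) • _
    simp only [smul_add, smul_smul, Complex.ofReal_div, mul_div_cancel₀ _ hk]
  rw [this]
  exact I.mul_mem_left _ _ hGI

end Operators

section Conjugation

lemma eK1_add (v w : Hsp) : eK1 (v + w) = eK1 v + eK1 w := by
  simp [eK1, ← WithLp.toLp_add]

lemma eK2_add (v w : Hsp) : eK2 (v + w) = eK2 v + eK2 w := by
  simp [eK2, ← WithLp.toLp_add]

lemma eK1_smul (c : ℂ) (v : Hsp) : eK1 (c • v) = c • eK1 v := by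
  simp [eK1, ← WithLp.toLp_smul]

lemma eK2_smul (c : ℂ) (v : Hsp) : eK2 (c • v) = c • eK2 v := by
  simp [eK2, ← WithLp.toLp_smul]

lemma dsum_eK1 (B : Hsp →L[ℂ] Hsp) (v : Hsp) : dsum B (eK1 v) = eK1 (B v) := by
  simp [dsum, eK1]

lemma dsum_eK2 (B : Hsp →L[ℂ] Hsp) (v : Hsp) : dsum B (eK2 v) = eK2 (B v) := by
  simp [dsum, eK2]

variable {U : Ksp ≃ₗᵢ[ℂ] Wsp} (hU : IsUmap U)
include hU

lemma map_eK1_eH {N I J : ℤ} (hJ : J < N) : U (eK1 (eH N I J)) = eD N I (J + 1) := by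
  by_cases h : validH (N, I, J)
  · exact hU.1 N I J h hJ.ne
  · have h' : ¬ validD (N, I, J + 1) := by
      simp only [validH, validD, abs_le] at h ⊢; omega
    simp [eH, eD, h, h', eK1]

lemma map_eK1_eH_self (N I : ℤ) : U (eK1 (eH N I N)) = eU N I (N + 1) := by
  by_cases h : validH (N, I, N)
  · exact hU.2.1 N I h
  · have h' : ¬ validU (N, I, N + 1) := by
      simp only [validH, validU, abs_le] at h ⊢; omega
    simp [eH, eU, h, h', eK1]

lemma map_eK2_eH {N I J : ℤ} (hJ : J ≤ N) : U (eK2 (eH N I J)) = eU N I (J - 1) := by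
  by_cases h : validH (N, I, J)
  · exact hU.2.2 N I J h
  · have h' : ¬ validU (N, I, J - 1) := by
      simp only [validH, validU, abs_le] at h ⊢; omega
    simp [eH, eU, h, h', eK2]

variable {q : ℝ} {B : Hsp →L[ℂ] Hsp} (hB : IsBetaHat q B)
include hB

lemma conj_betaHat_eU {N I J : ℤ} (h : validU (N, I, J)) (hJ : J < N) :
    U (dsum B (U.symm (eU N I J))) =
      (bC1 q N I (J + 1) : ℂ) • eU (N + 1) (I + 1) (J - 1)
      + (bC2 q N I (J + 1) : ℂ) • eU (N - 1) (I + 1) (J - 1) := by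
  have hv : validH (N, I, J + 1) := by simp only [validH, validU, abs_le] at h ⊢; omega
  have hs : U.symm (eU N I J) = eK2 (eH N I (J + 1)) := by
    rw [U.symm_apply_eq, map_eK2_eH hU (by omega)]; simp
  have h' := h.2.2.2.2
  rw [hs, dsum_eK2, hB _ _ _ hv, eK2_add, eK2_smul, eK2_smul, map_add, map_smul, map_smul,
    map_eK2_eH hU (by omega), map_eK2_eH hU (by dsimp at h'; omega), add_sub_cancel_right]

lemma conj_betaHat_eU_top {N I : ℤ} (h : validU (N, I, N + 1)) :
    U (dsum B (U.symm (eU N I (N + 1)))) =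
      (bC1 q N I N : ℂ) • eD (N + 1) (I + 1) N
      + (bC2 q N I N : ℂ) • eU (N - 1) (I + 1) N := by
  have hv : validH (N, I, N) := by simp only [validH, validU, abs_le] at h ⊢; omega
  have hs : U.symm (eU N I (N + 1)) = eK1 (eH N I N) := by
    rw [U.symm_apply_eq, map_eK1_eH_self hU]
  rw [hs, dsum_eK1, hB _ _ _ hv, eK1_add, eK1_smul, eK1_smul, map_add, map_smul, map_smul,
    map_eK1_eH hU (by omega), map_eK1_eH_self hU, sub_add_cancel]

lemma conj_betaHat_eD {N I J : ℤ} (h : validD (N, I, J)) :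
    U (dsum B (U.symm (eD N I J))) =
      (bC1 q N I (J - 1) : ℂ) • eD (N + 1) (I + 1) (J - 1)
      + (bC2 q N I (J - 1) : ℂ) • eD (N - 1) (I + 1) (J - 1) := by
  have hJ : J ≤ N - 1 := (abs_le.1 h.2.2.2.1).2
  have hv : validH (N, I, J - 1) := by simp only [validH, validD, abs_le] at h ⊢; omega
  have hs : U.symm (eD N I J) = eK1 (eH N I (J - 1)) := by
    rw [U.symm_apply_eq, map_eK1_eH hU (by omega)]; simp
  rw [hs, dsum_eK1, hB _ _ _ hv, eK1_add, eK1_smul, eK1_smul, map_add, map_smul, map_smul,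
    map_eK1_eH hU (by omega), map_eK1_eH hU (by omega), sub_add_cancel]

end Conjugation

section Bounds

variable {q n i j : ℝ}

lemma rpow_le_rpow_of_le (hq0 : 0 < q) (hq1 : q < 1) {a b : ℝ} (h : b ≤ a) : q ^ a ≤ q ^ b :=
  rpow_le_rpow_of_exponent_ge hq0 hq1.le h

lemma rpow_mul_rpow_le (hq0 : 0 < q) (hq1 : q < 1) {a b c : ℝ} (h : c ≤ a + b) :
    q ^ a * q ^ b ≤ q ^ c := by
  rw [← rpow_add hq0]
  exact rpow_le_rpow_of_le hq0 hq1 h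

lemma one_sub_rpow_two_pos (hq0 : 0 < q) (hq1 : q < 1) : 0 < 1 - q ^ (2 : ℝ) :=
  sub_pos.2 (rpow_lt_one hq0.le hq1 two_pos)

lemma one_sub_rpow_le (hq0 : 0 < q) (hq1 : q < 1) {a : ℝ} (h : 2 ≤ a) :
    1 - q ^ (2 : ℝ) ≤ 1 - q ^ a :=
  sub_le_sub_left (rpow_le_rpow_of_le hq0 hq1 h) 1

lemma abs_rpow_mul_div_sub_le (hq0 : 0 < q) (hq1 : q < 1) {a b c r s : ℝ} (hs0 : 0 ≤ s)
    (hs1 : s ≤ 1) (hb : 0 ≤ b) (hc : 2 ≤ c) (hab : r ≤ a + b) (hac : r ≤ a + c) :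
    |q ^ a * (s * √(1 - q ^ b) / (1 - q ^ c)) - q ^ a * s| ≤ 2 / (1 - q ^ (2 : ℝ)) * q ^ r :=
  abs_mul_div_sub_le (rpow_nonneg hq0.le _) hs0 hs1 (rpow_nonneg hq0.le _)
    (rpow_le_one hq0.le hq1.le hb) (rpow_nonneg hq0.le _) (one_sub_rpow_two_pos hq0 hq1)
    (one_sub_rpow_le hq0 hq1 hc) (rpow_mul_rpow_le hq0 hq1 hab) (rpow_mul_rpow_le hq0 hq1 hac)

lemma sqrt_one_sub_rpow_le_one (hq0 : 0 < q) (a : ℝ) : √(1 - q ^ a) ≤ 1 :=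
  sqrt_le_one_of_le (rpow_nonneg hq0.le a)

lemma abs_bP_zero_zero_sub_le (hq0 : 0 < q) (hq1 : q < 1) (hn : 0 ≤ n) (hj : -n - 1 / 2 ≤ j)
    (hj' : j ≤ n + 1 / 2) :
    |bP q n i j 0 0 - q ^ (n + j + 1 / 2) * √(1 - q ^ (2 * (n + i + 1)))|
      ≤ 2 / (1 - q ^ (2 : ℝ)) * q ^ n := by
  rw [bP_zero_zero hq0 hq1]
  exact abs_rpow_mul_div_sub_le hq0 hq1 (sqrt_nonneg _) (sqrt_one_sub_rpow_le_one hq0 _)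
    (by linarith) (by linarith) (by linarith) (by linarith)

lemma abs_bP_zero_zero_le (hq0 : 0 < q) (hq1 : q < 1) (hn : 0 ≤ n) (hj : -(1 / 2) ≤ j) :
    |bP q n i j 0 0| ≤ q ^ n / (1 - q ^ (2 : ℝ)) := by
  rw [bP_zero_zero hq0 hq1]
  refine (abs_mul_sqrt_mul_sqrt_div_le (rpow_nonneg hq0.le _) (sqrt_nonneg _)
    (sqrt_one_sub_rpow_le_one hq0 _) (sqrt_nonneg _) (sqrt_one_sub_rpow_le_one hq0 _)
    (one_sub_rpow_two_pos hq0 hq1) (one_sub_rpow_le hq0 hq1 (by linarith))).trans ?_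
  exact div_le_div_of_nonneg_right (rpow_le_rpow_of_le hq0 hq1 (by linarith))
    (one_sub_rpow_two_pos hq0 hq1).le

lemma abs_bP_one_one_sub_le (hq0 : 0 < q) (hq1 : q < 1) (hn : 1 / 2 ≤ n) (hj : -n + 1 / 2 ≤ j)
    (hj' : j ≤ n - 1 / 2) :
    |bP q n i j 1 1 - q ^ (n + j - 1 / 2) * √(1 - q ^ (2 * (n + i + 1)))|
      ≤ 2 / (1 - q ^ (2 : ℝ)) * q ^ n := by
  rw [bP_one_one hq0 hq1]
  exact abs_rpow_mul_div_sub_le hq0 hq1 (sqrt_nonneg _) (sqrt_one_sub_rpow_le_one hq0 _)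
    (by linarith) (by linarith) (by linarith) (by linarith)

lemma abs_bM_zero_zero_add_le (hq0 : 0 < q) (hq1 : q < 1) (hn : 0 ≤ n) (hi : -n ≤ i)
    (hi' : i ≤ n) :
    |bM q n i j 0 0 + q ^ (n + i) * √(1 - q ^ (2 * (n + j + 1 / 2)))|
      ≤ 2 / (1 - q ^ (2 : ℝ)) * q ^ n := by
  rw [bM_zero_zero hq0 hq1, ← abs_neg, neg_add, neg_neg, ← sub_eq_add_neg, mul_comm √_]
  exact abs_rpow_mul_div_sub_le hq0 hq1 (sqrt_nonneg _) (sqrt_one_sub_rpow_le_one hq0 _)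
    (by linarith) (by linarith) (by linarith) (by linarith)

lemma abs_bM_one_one_add_le (hq0 : 0 < q) (hq1 : q < 1) (hn : 1 / 2 ≤ n) (hi : -n ≤ i)
    (hi' : i ≤ n) :
    |bM q n i j 1 1 + q ^ (n + i) * √(1 - q ^ (2 * (n + j - 1 / 2)))|
      ≤ 2 / (1 - q ^ (2 : ℝ)) * q ^ n := by
  rw [bM_one_one hq0 hq1, ← abs_neg, neg_add, neg_neg, ← sub_eq_add_neg, mul_comm √_]
  exact abs_rpow_mul_div_sub_le hq0 hq1 (sqrt_nonneg _) (sqrt_one_sub_rpow_le_one hq0 _)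
    (by linarith) (by linarith) (by linarith) (by linarith)

lemma abs_rpow_mul_cross_le (hq0 : 0 < q) (hq1 : q < 1) {a r c d s t : ℝ} (hs0 : 0 ≤ s)
    (hs1 : s ≤ 1) (ht0 : 0 ≤ t) (ht1 : t ≤ 1) (hc : 2 ≤ c) (hd : 2 ≤ d) (hr : r ≤ a) :
    |-(q ^ a * ((q⁻¹ - q) * (s * t / ((1 - q ^ c) * (1 - q ^ d)))))|
      ≤ (q⁻¹ - q) / (1 - q ^ (2 : ℝ)) ^ 2 * q ^ r := by
  have hκ := inv_sub_self_pos hq0 hq1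
  have h2 := one_sub_rpow_two_pos hq0 hq1
  have hcd : (1 - q ^ (2 : ℝ)) ^ 2 ≤ (1 - q ^ c) * (1 - q ^ d) := by
    rw [sq]
    exact mul_le_mul (one_sub_rpow_le hq0 hq1 hc) (one_sub_rpow_le hq0 hq1 hd) h2.le
      (h2.le.trans (one_sub_rpow_le hq0 hq1 hc))
  rw [abs_neg, ← mul_assoc]
  refine (abs_mul_sqrt_mul_sqrt_div_le (mul_nonneg (rpow_nonneg hq0.le _) hκ.le) hs0 hs1 ht0 ht1
    (pow_pos h2 2) hcd).trans ?_
  rw [mul_comm, ← div_mul_eq_mul_div]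
  exact mul_le_mul_of_nonneg_left (rpow_le_rpow_of_le hq0 hq1 hr) (by positivity)

lemma abs_bP_one_zero_le (hq0 : 0 < q) (hq1 : q < 1) (hn : 0 ≤ n) :
    |bP q n i j 1 0| ≤ (q⁻¹ - q) / (1 - q ^ (2 : ℝ)) ^ 2 * q ^ n := by
  rw [bP_one_zero hq0 hq1]
  exact abs_rpow_mul_cross_le hq0 hq1 (sqrt_nonneg _) (sqrt_one_sub_rpow_le_one hq0 _)
    (sqrt_nonneg _) (sqrt_one_sub_rpow_le_one hq0 _) (by linarith) (by linarith) (by linarith)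

lemma abs_bM_zero_one_le (hq0 : 0 < q) (hq1 : q < 1) (hn : 1 / 2 ≤ n) (hi : -n ≤ i)
    (hj : -n + 1 / 2 ≤ j) :
    |bM q n i j 0 1| ≤ (q⁻¹ - q) / (1 - q ^ (2 : ℝ)) ^ 2 * q ^ n := by
  rw [bM_zero_one hq0 hq1]
  exact abs_rpow_mul_cross_le hq0 hq1 (sqrt_nonneg _) (sqrt_one_sub_rpow_le_one hq0 _)
    (sqrt_nonneg _) (sqrt_one_sub_rpow_le_one hq0 _) (by linarith) (by linarith) (by linarith)

lemma abs_rpow_mul_sqrt_sub_sqrt_le (hq0 : 0 < q) (hq1 : q < 1) {a b c r : ℝ} (ha : 0 ≤ a)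
    (hb : 0 ≤ b) (hc : 0 ≤ c) (hbr : r ≤ b) (hcr : r ≤ c) :
    |q ^ a * √(1 - q ^ b) - q ^ a * √(1 - q ^ c)| ≤ q ^ r := by
  have hb1 := one_sub_sqrt_le (rpow_nonneg hq0.le b) (rpow_le_one hq0.le hq1.le hb)
  have hc1 := one_sub_sqrt_le (rpow_nonneg hq0.le c) (rpow_le_one hq0.le hq1.le hc)
  have hb2 := sqrt_one_sub_rpow_le_one hq0 b
  have hc2 := sqrt_one_sub_rpow_le_one hq0 c
  have hb3 := rpow_le_rpow_of_le hq0 hq1 hbr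
  have hc3 := rpow_le_rpow_of_le hq0 hq1 hcr
  rw [← mul_sub, abs_mul, abs_of_pos (rpow_pos_of_pos hq0 a)]
  exact (mul_le_of_le_one_left (abs_nonneg _) (rpow_le_one hq0.le hq1.le ha)).trans
    (abs_le.2 ⟨by linarith, by linarith⟩)

end Bounds

section ErrorTerms

variable {q : ℝ}

/-- A constant dominating all coefficients of `U(β̂ ⊕ β̂)U* − π'(β)` relative to `q^n`. -/
def errorConst (q : ℝ) : ℝ := (4 + (q⁻¹ - q)) / (1 - q ^ (2 : ℝ)) ^ 2

lemma two_div_add_one_le_errorConst (hq0 : 0 < q) (hq1 : q < 1) :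
    2 / (1 - q ^ (2 : ℝ)) + 1 ≤ errorConst q := by
  have hκ := inv_sub_self_pos hq0 hq1
  have hd := one_sub_rpow_two_pos hq0 hq1
  have hd1 : 1 - q ^ (2 : ℝ) ≤ 1 := sub_le_self _ (rpow_nonneg hq0.le _)
  rw [errorConst, div_add_one hd.ne', div_le_div_iff₀ hd (pow_pos hd 2)]
  rw [sq, ← mul_assoc]
  gcongr
  exact (mul_le_of_le_one_right (by linarith) hd1).trans (by linarith)

lemma one_add_div_le_errorConst (hq0 : 0 < q) (hq1 : q < 1) :
    1 + (q⁻¹ - q) / (1 - q ^ (2 : ℝ)) ^ 2 ≤ errorConst q := by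
  have hd := one_sub_rpow_two_pos hq0 hq1
  have hd1 : 1 - q ^ (2 : ℝ) ≤ 1 := sub_le_self _ (rpow_nonneg hq0.le _)
  rw [errorConst, one_add_div (pow_pos hd 2).ne']
  gcongr
  exact (pow_le_one₀ hd.le hd1).trans (by norm_num)

lemma bC1_eq (N I J : ℤ) :
    bC1 q N I J = -(q ^ (nn N + nn J) * √(1 - q ^ (2 * (nn N + nn I + 1)))) := by
  unfold bC1 nn
  ring_nf

lemma bC2_eq (N I J : ℤ) :
    bC2 q N I J = q ^ (nn N + nn I) * √(1 - q ^ (2 * (nn N + nn J))) := by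
  unfold bC2 nn
  ring_nf

lemma nn_add_one (J : ℤ) : nn (J + 1) = nn J + 1 / 2 := by
  unfold nn; push_cast; ring

lemma nn_sub_one (J : ℤ) : nn (J - 1) = nn J - 1 / 2 := by
  unfold nn; push_cast; ring

lemma nn_le_nn {M N : ℤ} (h : M ≤ N) : nn M ≤ nn N := by
  unfold nn; gcongr

lemma nn_neg (N : ℤ) : nn (-N) = -nn N := by
  unfold nn; push_cast; ring

lemma neg_nn_le {M N : ℤ} (h : |M| ≤ N) : -nn N ≤ nn M := by
  rw [← nn_neg]; exact nn_le_nn (abs_le.1 h).1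

lemma nn_le {M N : ℤ} (h : |M| ≤ N) : nn M ≤ nn N := nn_le_nn (abs_le.1 h).2

lemma nn_nonneg {N : ℤ} (h : 0 ≤ N) : 0 ≤ nn N := by
  simpa [nn] using nn_le_nn h

variable {D P : Wsp →L[ℂ] Wsp} {N I J : ℤ}

lemma sub_eU_eq (hq0 : 0 < q) (hq1 : q < 1) (hP : IsPiBeta q P)
    (h : validU (N, I, J))
    (hD : D (eU N I J) = (bC1 q N I (J + 1) : ℂ) • eU (N + 1) (I + 1) (J - 1)
      + (bC2 q N I (J + 1) : ℂ) • eU (N - 1) (I + 1) (J - 1)) :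
    ∃ a b c : ℝ, |a| ≤ errorConst q * q ^ nn N ∧ |b| ≤ errorConst q * q ^ nn N ∧
      |c| ≤ errorConst q * q ^ nn N ∧
      (D - P) (eU N I J) = (a : ℂ) • eU (N + 1) (I + 1) (J - 1)
        + (b : ℂ) • eU (N - 1) (I + 1) (J - 1) + (c : ℂ) • eD (N + 1) (I + 1) (J - 1) := by
  have hE1 := two_div_add_one_le_errorConst hq0 hq1
  have hE2 := one_add_div_le_errorConst hq0 hq1
  have hr : 0 < q ^ nn N := rpow_pos_of_pos hq0 _
  have hN := nn_nonneg h.1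
  have hJ := neg_nn_le h.2.2.2.1
  have hJ' := nn_le h.2.2.2.1
  dsimp only at hN hJ hJ'
  rw [nn_add_one] at hJ hJ'
  refine ⟨bP q (nn N) (nn I) (nn J) 0 0 + bC1 q N I (J + 1),
    bM q (nn N) (nn I) (nn J) 0 0 + bC2 q N I (J + 1), bP q (nn N) (nn I) (nn J) 1 0,
    ?_, ?_, ?_, ?_⟩
  · rw [bC1_eq, nn_add_one, ← add_assoc, ← sub_eq_add_neg]
    refine (abs_bP_zero_zero_sub_le hq0 hq1 hN (by linarith) (by linarith)).trans ?_
    gcongr; linarith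
  · rw [bC2_eq, nn_add_one, ← add_assoc]
    refine (abs_bM_zero_zero_add_le hq0 hq1 hN (neg_nn_le h.2.1) (nn_le h.2.1)).trans ?_
    gcongr; linarith
  · refine (abs_bP_one_zero_le hq0 hq1 hN).trans ?_
    gcongr; linarith
  · rw [sub_apply, hD, hP.1 N I J h, bM_one_zero]
    push_cast
    module

lemma sub_eU_top_eq (hq0 : 0 < q) (hq1 : q < 1) (hP : IsPiBeta q P)
    (h : validU (N, I, N + 1))
    (hD : D (eU N I (N + 1)) = (bC1 q N I N : ℂ) • eD (N + 1) (I + 1) N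
      + (bC2 q N I N : ℂ) • eU (N - 1) (I + 1) N) :
    ∃ a b c : ℝ, |a| ≤ errorConst q * q ^ nn N ∧ |b| ≤ errorConst q * q ^ nn N ∧
      |c| ≤ errorConst q * q ^ nn N ∧
      (D - P) (eU N I (N + 1)) = (a : ℂ) • eU (N + 1) (I + 1) (N + 1 - 1)
        + (b : ℂ) • eU (N - 1) (I + 1) (N + 1 - 1)
        + (c : ℂ) • eD (N + 1) (I + 1) (N + 1 - 1) := by
  have hE1 := two_div_add_one_le_errorConst hq0 hq1
  have hE2 := one_add_div_le_errorConst hq0 hq1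
  have hd := one_sub_rpow_two_pos hq0 hq1
  have hr : 0 < q ^ nn N := rpow_pos_of_pos hq0 _
  have hN := nn_nonneg h.1
  have hI := neg_nn_le h.2.1
  have hI' := nn_le h.2.1
  dsimp only at hN hI hI'
  refine ⟨bP q (nn N) (nn I) (nn (N + 1)) 0 0,
    bM q (nn N) (nn I) (nn (N + 1)) 0 0 + bC2 q N I N,
    bP q (nn N) (nn I) (nn (N + 1)) 1 0 + bC1 q N I N, ?_, ?_, ?_, ?_⟩
  · refine (abs_bP_zero_zero_le hq0 hq1 hN (by rw [nn_add_one]; linarith)).trans ?_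
    rw [← one_div_mul_eq_div]
    have : 1 / (1 - q ^ (2 : ℝ)) ≤ 2 / (1 - q ^ (2 : ℝ)) := by gcongr; norm_num
    gcongr; linarith
  · have hs := abs_rpow_mul_sqrt_sub_sqrt_le hq0 hq1 (a := nn N + nn I) (b := 2 * (nn N + nn N))
      (c := 2 * (nn N + nn (N + 1) + 1 / 2)) (r := nn N) (by linarith) (by linarith)
      (by rw [nn_add_one]; linarith) (by linarith) (by rw [nn_add_one]; linarith)
    have hb := abs_bM_zero_zero_add_le hq0 hq1 hN hI hI' (j := nn (N + 1))
    rw [bC2_eq, ← add_add_sub_cancel _ _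
      (q ^ (nn N + nn I) * √(1 - q ^ (2 * (nn N + nn (N + 1) + 1 / 2))))]
    refine (abs_add_le _ _).trans ((add_le_add hb hs).trans ?_)
    rw [← add_one_mul]
    gcongr
  · have hc : |bC1 q N I N| ≤ q ^ nn N := by
      rw [bC1_eq, abs_neg, abs_of_nonneg (by positivity)]
      exact (mul_le_of_le_one_right (rpow_nonneg hq0.le _) (sqrt_one_sub_rpow_le_one hq0 _)).trans
        (rpow_le_rpow_of_le hq0 hq1 (by linarith))
    refine (abs_add_le _ _).trans ((add_le_add (abs_bP_one_zero_le hq0 hq1 hN) hc).trans ?_)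
    rw [← add_one_mul, add_comm _ (1 : ℝ)]
    gcongr
  · rw [sub_apply, hD, hP.1 N I (N + 1) h, bM_one_zero, add_sub_cancel_right]
    push_cast
    module

lemma sub_eD_eq (hq0 : 0 < q) (hq1 : q < 1) (hP : IsPiBeta q P)
    (h : validD (N, I, J))
    (hD : D (eD N I J) = (bC1 q N I (J - 1) : ℂ) • eD (N + 1) (I + 1) (J - 1)
      + (bC2 q N I (J - 1) : ℂ) • eD (N - 1) (I + 1) (J - 1)) :
    ∃ a b c : ℝ, |a| ≤ errorConst q * q ^ nn N ∧ |b| ≤ errorConst q * q ^ nn N ∧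
      |c| ≤ errorConst q * q ^ nn N ∧
      (D - P) (eD N I J) = (a : ℂ) • eD (N + 1) (I + 1) (J - 1)
        + (b : ℂ) • eD (N - 1) (I + 1) (J - 1) + (c : ℂ) • eU (N - 1) (I + 1) (J - 1) := by
  have hE1 := two_div_add_one_le_errorConst hq0 hq1
  have hE2 := one_add_div_le_errorConst hq0 hq1
  have hr : 0 < q ^ nn N := rpow_pos_of_pos hq0 _
  have hN : 1 / 2 ≤ nn N := by simpa [nn] using nn_le_nn h.1
  have hI := neg_nn_le h.2.1
  have hJ := neg_nn_le h.2.2.2.1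
  have hJ' := nn_le h.2.2.2.1
  dsimp only at hI hJ hJ'
  rw [nn_sub_one] at hJ hJ'
  refine ⟨bP q (nn N) (nn I) (nn J) 1 1 + bC1 q N I (J - 1),
    bM q (nn N) (nn I) (nn J) 1 1 + bC2 q N I (J - 1), bM q (nn N) (nn I) (nn J) 0 1,
    ?_, ?_, ?_, ?_⟩
  · rw [bC1_eq, nn_sub_one, ← add_sub_assoc, ← sub_eq_add_neg]
    refine (abs_bP_one_one_sub_le hq0 hq1 hN (by linarith) (by linarith)).trans ?_
    gcongr; linarith
  · rw [bC2_eq, nn_sub_one, ← add_sub_assoc]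
    refine (abs_bM_one_one_add_le hq0 hq1 hN hI (nn_le h.2.1)).trans ?_
    gcongr; linarith
  · refine (abs_bM_zero_one_le hq0 hq1 hN hI (by linarith)).trans ?_
    gcongr; linarith
  · rw [sub_apply, hD, hP.2 N I J h, bP_zero_one]
    push_cast
    module

end ErrorTerms

/-- The operator `U(β̂ ⊕ β̂)U* − π'(β)` on `𝓗` belongs to `K_q`, the smallest
norm-closed two-sided ideal of the bounded operators on `𝓗` containing the diagonal operator
`Γ_q`; equivalently, it belongs to every closed two-sided ideal containing `Γ_q`. -/
theorem conj_betaHat_sub_piBeta_mem_ideal (q : ℝ) (hq0 : 0 < q) (hq1 : q < 1)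
    (B : Hsp →L[ℂ] Hsp) (hB : IsBetaHat q B)
    (P : Wsp →L[ℂ] Wsp) (hP : IsPiBeta q P)
    (U : Ksp ≃ₗᵢ[ℂ] Wsp) (hU : IsUmap U)
    (G : Wsp →L[ℂ] Wsp) (hG : IsGammaQ q G)
    (I : TwoSidedIdeal (Wsp →L[ℂ] Wsp)) (hIclosed : IsClosed (I : Set (Wsp →L[ℂ] Wsp)))
    (hGI : G ∈ I) :
    (U.toLinearIsometry.toContinuousLinearMap.comp
        ((dsum B).comp U.symm.toLinearIsometry.toContinuousLinearMap))
      - P ∈ I := by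
  refine mem_of_shift_coeff_bound hq0 hG hGI (C := errorConst q) ?_
  rintro (⟨⟨N, I, J⟩, h⟩ | ⟨⟨N, I, J⟩, h⟩)
  · have he := eU_eq_single ⟨(N, I, J), h⟩
    rw [← he]
    rcases lt_or_ge J N with hJ | hJ
    · exact sub_eU_eq hq0 hq1 hP h (conj_betaHat_eU hU hB h hJ)
    · obtain rfl : J = N + 1 := by
        simp only [validU, abs_le] at h; omega
      exact sub_eU_top_eq hq0 hq1 hP h (conj_betaHat_eU_top hU hB h)
  · have he := eD_eq_single ⟨(N, I, J), h⟩
    rw [← he]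
    exact sub_eD_eq hq0 hq1 hP h (conj_betaHat_eD hU hB h)
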